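/- Let W be a d×n real matrix with nonnegative entries, x ∈ ℝ^d with nonnegative entries, and λ > 0, τ > 0. Define L(h) = ‖x − Wh‖₂² + λ·Σ_{i=1}^n log(τ + h_i²). Let h̄ ∈ ℝ^n have strictly positive entries, suppose each denominator (WᵀWh̄)_i + λ·h̄_i/(τ + h̄_i²) is strictly positive, and define the reweighted ℓ₂ multiplicative update h⁺_i = h̄_i·(Wᵀx)_i / ((WᵀWh̄)_i + λ·h̄_i/(τ + h̄_i²)). Then every entry of h⁺ is nonnegative and L(h⁺) ≤ L(h̄). -/

import Mathlib

open Matrix BigOperators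

/-- Transposing a matrix across a sum of products. -/
lemma sum_mul_mulVec_eq_sum_transpose_mulVec_mul {m n : Type*} [Fintype m] [Fintype n]
    (W : Matrix m n ℝ) (u : m → ℝ) (v : n → ℝ) :
    ∑ i, u i * (W *ᵥ v) i = ∑ j, (Wᵀ *ᵥ u) j * v j := by
  have h := dotProduct_mulVec u W v
  rwa [← mulVec_transpose] at h

/-- The diagonal majorization of the Gram matrix of a nonnegative matrix that underlies
multiplicative updates. -/
lemma sum_sq_mulVec_le {m n : Type*} [Fintype m] [Fintype n]
    (W : Matrix m n ℝ) (hW : ∀ i j, 0 ≤ W i j) (h : n → ℝ) (hh : ∀ j, 0 < h j) (δ : n → ℝ) :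
    ∑ i, (W *ᵥ δ) i ^ 2 ≤ ∑ j, ((Wᵀ * W) *ᵥ h) j * (δ j ^ 2 / h j) := by
  rw [← mulVec_mulVec, ← sum_mul_mulVec_eq_sum_transpose_mulVec_mul]
  refine Finset.sum_le_sum fun i _ => ?_
  refine Finset.sum_sq_le_sum_mul_sum_of_sq_le_mul _ (fun j _ => mul_nonneg (hW i j) (hh j).le)
    (fun j _ => mul_nonneg (hW i j) (div_nonneg (sq_nonneg _) (hh j).le)) fun j _ => le_of_eq ?_
  have := (hh j).ne'
  field_simp

/-- Expansion of the least-squares residual around a point. -/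
lemma sum_sq_sub_mulVec_add {m n : Type*} [Fintype m] [Fintype n]
    (W : Matrix m n ℝ) (x : m → ℝ) (h δ : n → ℝ) :
    ∑ i, (x i - (W *ᵥ (h + δ)) i) ^ 2 = ∑ i, (x i - (W *ᵥ h) i) ^ 2
      - 2 * ∑ j, ((Wᵀ *ᵥ x) j - ((Wᵀ * W) *ᵥ h) j) * δ j + ∑ i, (W *ᵥ δ) i ^ 2 := by
  have hcross : ∑ j, ((Wᵀ *ᵥ x) j - ((Wᵀ * W) *ᵥ h) j) * δ j
      = ∑ i, (x i - (W *ᵥ h) i) * (W *ᵥ δ) i := by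
    have := sum_mul_mulVec_eq_sum_transpose_mulVec_mul W (x - W *ᵥ h) δ
    rw [mulVec_sub, mulVec_mulVec] at this
    exact this.symm
  rw [hcross, Finset.mul_sum, ← Finset.sum_sub_distrib, ← Finset.sum_add_distrib]
  refine Finset.sum_congr rfl fun i _ => ?_
  rw [mulVec_add, Pi.add_apply]
  ring

/-- The tangent-line bound for the logarithm. -/
lemma log_le_log_add_sub_div {a b : ℝ} (ha : 0 < a) (hb : 0 < b) :
    Real.log b ≤ Real.log a + (b - a) / a := by
  have h := Real.log_le_sub_one_of_pos (div_pos hb ha)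
  rw [Real.log_div hb.ne' ha.ne'] at h
  rw [sub_div, div_self ha.ne']
  linarith

/-- The reweighted ℓ₂ multiplicative update preserves non-negativity and does not
increase the reweighted ℓ₂ S-NNLS objective. -/
theorem stmt_16 (d n : ℕ)
    (W : Matrix (Fin d) (Fin n) ℝ) (hW : ∀ i j, 0 ≤ W i j)
    (x : Fin d → ℝ) (hx : ∀ i, 0 ≤ x i)
    (lam τ : ℝ) (hlam : 0 < lam) (hτ : 0 < τ)
    (L : (Fin n → ℝ) → ℝ)
    (hL : ∀ h, L h = ∑ i, (x i - W.mulVec h i) ^ 2 + lam * ∑ i, Real.log (τ + h i ^ 2))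
    (hbar : Fin n → ℝ) (hpos : ∀ i, 0 < hbar i)
    (hden : ∀ i, 0 < (Wᵀ * W).mulVec hbar i + lam * hbar i / (τ + hbar i ^ 2))
    (hplus : Fin n → ℝ)
    (hplusdef : ∀ i, hplus i =
      hbar i * Wᵀ.mulVec x i / ((Wᵀ * W).mulVec hbar i + lam * hbar i / (τ + hbar i ^ 2))) :
    (∀ i, 0 ≤ hplus i) ∧ L hplus ≤ L hbar := by
  have hnonneg : ∀ i, 0 ≤ hplus i := fun i => by
    have hWx : 0 ≤ (Wᵀ *ᵥ x) i := dotProduct_nonneg_of_nonneg (fun j => hW j i) hx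
    rw [hplusdef]
    exact div_nonneg (mul_nonneg (hpos i).le hWx) (hden i).le
  refine ⟨hnonneg, ?_⟩
  obtain ⟨δ, rfl⟩ : ∃ δ, hplus = hbar + δ := ⟨hplus - hbar, by simp⟩
  have hlog : lam * ∑ i, Real.log (τ + (hbar + δ) i ^ 2) ≤ lam * ∑ i, Real.log (τ + hbar i ^ 2)
      + ∑ i, lam * ((2 * hbar i * δ i + δ i ^ 2) / (τ + hbar i ^ 2)) := by
    rw [← Finset.mul_sum, ← mul_add, ← Finset.sum_add_distrib]
    refine mul_le_mul_of_nonneg_left (Finset.sum_le_sum fun i _ => ?_) hlam.le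
    refine (log_le_log_add_sub_div (a := τ + hbar i ^ 2) (by positivity)
      (by positivity)).trans_eq ?_
    rw [Pi.add_apply]
    ring
  have hdecrease : ∑ i, (-2 * (((Wᵀ *ᵥ x) i - ((Wᵀ * W) *ᵥ hbar) i) * δ i)
      + ((Wᵀ * W) *ᵥ hbar) i * (δ i ^ 2 / hbar i)
      + lam * ((2 * hbar i * δ i + δ i ^ 2) / (τ + hbar i ^ 2))) ≤ 0 := by
    refine Finset.sum_nonpos fun i _ => ?_
    have hD := hden i
    have hp := hpos i
    have hτi : 0 < τ + hbar i ^ 2 := by positivity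
    have hfix := hplusdef i
    rw [eq_div_iff hD.ne', Pi.add_apply] at hfix
    set a := ((Wᵀ * W) *ᵥ hbar) i
    set D := a + lam * hbar i / (τ + hbar i ^ 2) with hDdef
    have hb : (Wᵀ *ᵥ x) i = D + D * δ i / hbar i := by
      field_simp
      linarith
    have ha : a = D - lam * hbar i / (τ + hbar i ^ 2) := by rw [hDdef]; ring
    have hval : -2 * (((Wᵀ *ᵥ x) i - a) * δ i) + a * (δ i ^ 2 / hbar i)
        + lam * ((2 * hbar i * δ i + δ i ^ 2) / (τ + hbar i ^ 2)) = -(D * (δ i ^ 2 / hbar i)) := by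
      clear_value D
      rw [hb, ha]
      field_simp
      ring
    rw [hval, neg_nonpos]
    positivity
  rw [Finset.sum_add_distrib, Finset.sum_add_distrib, ← Finset.mul_sum] at hdecrease
  rw [hL, hL, sum_sq_sub_mulVec_add]
  linarith [sum_sq_mulVec_le W hW hbar hpos δ]
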